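/- arXiv:1703.02723 — 4 statements merged into one kernel-verified Lean document; each statement's English description precedes it below -/
import Mathlib

section
/- Greedy guarantee for weakly submodular functions (Das–Kempe): Let f be a monotone set function with f(∅) = 0 on a finite candidate set S, let A_k = Greedy(S, k) be the output of the deterministic greedy algorithm run for k steps, and suppose f has submodularity ratio at least γ > 0 with respect to (A_k, k). Then for every subset S* ⊆ S with |S*| ≤ k, f(A_k) ≥ (1 − e^{−γ})·f(S*). -/
open Finset

open scoped Classical in
/-- One step of the deterministic greedy algorithm: add to `A` the element of `S \ A`
maximizing the marginal gain `f (insert j A) - f A`, ties broken by the fixed linear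
order on `Fin d`. -/
noncomputable def greedyStep {d : ℕ} (f : Finset (Fin d) → ℝ) (S A : Finset (Fin d)) :
    Finset (Fin d) :=
  if h : (S \ A).Nonempty then
    insert
      (((S \ A).filter fun j => ∀ j' ∈ S \ A, f (insert j' A) ≤ f (insert j A)).min'
        (by
          obtain ⟨j, hj, hmax⟩ := (S \ A).exists_max_image (fun j => f (insert j A)) h
          exact ⟨j, Finset.mem_filter.mpr ⟨hj, hmax⟩⟩)) A
  else A

/-- `greedy f S k` is the set produced by `k` steps of greedy selection from candidates `S`,
starting from `∅`. -/
noncomputable def greedy {d : ℕ} (f : Finset (Fin d) → ℝ) (S : Finset (Fin d)) :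
    ℕ → Finset (Fin d)
  | 0 => ∅
  | k + 1 => greedyStep f S (greedy f S k)

/-- `f` has submodularity ratio at least `γ` with respect to `(U, k)`:
for every `L ⊆ U` and every `S` disjoint from `L` with `|S| ≤ k`,
`∑_{j ∈ S} (f (L ∪ {j}) - f L) ≥ γ · (f (L ∪ S) - f L)`. -/
def SubmodRatioGE {d : ℕ} (f : Finset (Fin d) → ℝ) (U : Finset (Fin d)) (k : ℕ) (γ : ℝ) : Prop :=
  ∀ L S : Finset (Fin d), L ⊆ U → Disjoint L S → S.card ≤ k →
    γ * (f (L ∪ S) - f L) ≤ ∑ j ∈ S, (f (insert j L) - f L)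

theorem subset_greedyStep {d : ℕ} (f : Finset (Fin d) → ℝ) (S A : Finset (Fin d)) :
    A ⊆ greedyStep f S A := by
  unfold greedyStep
  split_ifs
  · exact Finset.subset_insert _ _
  · exact Finset.Subset.refl A

theorem apply_insert_le_apply_greedyStep {d : ℕ} (f : Finset (Fin d) → ℝ) (S A : Finset (Fin d))
    {j : Fin d} (hj : j ∈ S \ A) : f (insert j A) ≤ f (greedyStep f S A) := by
  unfold greedyStep
  rw [dif_pos ⟨j, hj⟩]
  have hmax {i : Fin d} {p : Fin d → Prop} [DecidablePred p] (hi : i ∈ (S \ A).filter p) : p i :=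
    (Finset.mem_filter.mp hi).2
  exact hmax (p := fun i => ∀ j' ∈ S \ A, f (insert j' A) ≤ f (insert i A))
    (Finset.min'_mem _ _) j hj

theorem greedy_monotone {d : ℕ} (f : Finset (Fin d) → ℝ) (S : Finset (Fin d)) :
    Monotone (greedy f S) :=
  monotone_nat_of_le_succ fun i => subset_greedyStep f S (greedy f S i)

/-- Each greedy step closes at least a `γ / k` fraction of the gap to any competitor `T`. -/
theorem mul_gap_le_mul_greedyStep_gain {d k : ℕ} {f : Finset (Fin d) → ℝ}
    (hmono : ∀ A B : Finset (Fin d), A ⊆ B → f A ≤ f B) {S U A T : Finset (Fin d)} {γ : ℝ}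
    (hγ : 0 ≤ γ) (hsub : SubmodRatioGE f U k γ) (hA : A ⊆ U) (hT : T ⊆ S) (hcard : T.card ≤ k) :
    γ * (f T - f A) ≤ k * (f (greedyStep f S A) - f A) := by
  have hcard' : (T \ A).card ≤ k := (Finset.card_le_card Finset.sdiff_subset).trans hcard
  have hgain : 0 ≤ f (greedyStep f S A) - f A :=
    sub_nonneg.mpr (hmono _ _ (subset_greedyStep f S A))
  calc γ * (f T - f A) ≤ γ * (f (A ∪ T \ A) - f A) := by
        gcongr
        exact hmono _ _ (by rw [Finset.union_sdiff_self_eq_union]; exact Finset.subset_union_right)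
    _ ≤ ∑ j ∈ T \ A, (f (insert j A) - f A) := hsub A _ hA Finset.disjoint_sdiff hcard'
    _ ≤ ∑ _j ∈ T \ A, (f (greedyStep f S A) - f A) := by
        refine Finset.sum_le_sum fun j hj => sub_le_sub_right ?_ _
        exact apply_insert_le_apply_greedyStep f S A (Finset.sdiff_subset_sdiff hT subset_rfl hj)
    _ = (T \ A).card * (f (greedyStep f S A) - f A) := by
        rw [Finset.sum_const, nsmul_eq_mul]
    _ ≤ k * (f (greedyStep f S A) - f A) := by gcongr

/-- The gap to a competitor decays geometrically along the greedy run. -/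
theorem gap_greedy_le {d k : ℕ} {f : Finset (Fin d) → ℝ}
    (hmono : ∀ A B : Finset (Fin d), A ⊆ B → f A ≤ f B) (hzero : f ∅ = 0)
    {S T : Finset (Fin d)} {γ : ℝ} (hγ : 0 ≤ γ) (hk : 0 < k)
    (hsub : SubmodRatioGE f (greedy f S k) k γ) (hT : T ⊆ S) (hcard : T.card ≤ k) :
    ∀ i ≤ k, f T - f (greedy f S i) ≤ Real.exp (-(γ / k)) ^ i * f T := by
  have hfT : 0 ≤ f T := hzero ▸ hmono _ _ (Finset.empty_subset T)
  intro i
  induction i with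
  | zero => simp [greedy, hzero]
  | succ i ih =>
    intro hi
    specialize ih (Nat.le_of_succ_le hi)
    have hle : f (greedy f S i) ≤ f (greedy f S (i + 1)) :=
      hmono _ _ (greedy_monotone f S (Nat.le_succ i))
    rcases le_total (f T - f (greedy f S i)) 0 with hneg | hpos
    · have : 0 ≤ Real.exp (-(γ / k)) ^ (i + 1) * f T := by positivity
      linarith
    · have hstep : γ * (f T - f (greedy f S i)) ≤
          k * (f (greedy f S (i + 1)) - f (greedy f S i)) :=
        mul_gap_le_mul_greedyStep_gain hmono hγ hsub
          (greedy_monotone f S (Nat.le_of_succ_le hi)) hT hcard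
      have hk' : (0 : ℝ) < k := Nat.cast_pos.mpr hk
      have hdiv : γ / k * (f T - f (greedy f S i)) ≤
          f (greedy f S (i + 1)) - f (greedy f S i) := by
        rw [div_mul_eq_mul_div, div_le_iff₀' hk']
        exact hstep
      calc f T - f (greedy f S (i + 1))
          ≤ (-(γ / k) + 1) * (f T - f (greedy f S i)) := by linarith
        _ ≤ Real.exp (-(γ / k)) * (f T - f (greedy f S i)) := by
            gcongr
            exact Real.add_one_le_exp _
        _ ≤ Real.exp (-(γ / k)) * (Real.exp (-(γ / k)) ^ i * f T) := by gcongr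
        _ = Real.exp (-(γ / k)) ^ (i + 1) * f T := by ring

/-- **Greedy guarantee for weakly submodular functions (Das–Kempe).**
If `f` is monotone with `f ∅ = 0`, `A_k = Greedy(S, k)`, and `f` has submodularity ratio at
least `γ > 0` with respect to `(A_k, k)`, then for every `S* ⊆ S` with `|S*| ≤ k`,
`f (A_k) ≥ (1 - e^{-γ}) · f S*`. -/
theorem greedy_weakly_submodular_guarantee (d k : ℕ) (f : Finset (Fin d) → ℝ)
    (hmono : ∀ A B : Finset (Fin d), A ⊆ B → f A ≤ f B) (hzero : f ∅ = 0)
    (S : Finset (Fin d)) (γ : ℝ) (hγ : 0 < γ)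
    (hsub : SubmodRatioGE f (greedy f S k) k γ) :
    ∀ Sstar : Finset (Fin d), Sstar ⊆ S → Sstar.card ≤ k →
      (1 - Real.exp (-γ)) * f Sstar ≤ f (greedy f S k) := by
  intro T hT hcard
  rcases Nat.eq_zero_or_pos k with rfl | hk
  · rw [Finset.card_eq_zero.mp (Nat.le_zero.mp hcard)]
    simp [greedy, hzero]
  · have h := gap_greedy_le hmono hzero hγ.le hk hsub hT hcard k le_rfl
    have hexp : Real.exp (-(γ / k)) ^ k = Real.exp (-γ) := by
      rw [← Real.exp_nat_mul, mul_neg, mul_div_cancel₀ γ (Nat.cast_ne_zero.mpr hk.ne')]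
    rw [hexp] at h
    linarith
end

section
/- In the DistributedGreedy setup, where each element of the ground set Fin d is assigned independently and uniformly at random to one of l machines, producing a random partition A_1, …, A_l, and G_j = Greedy(A_j, k): for any element x of the ground set, P(x ∈ G_1 ∪ ⋯ ∪ G_l) = (1/l)·∑_{j=1}^{l} P(x ∈ Greedy(A_j ∪ {x}, k)). -/
open Finset

/-- The set of elements assigned to machine `j` by the random assignment `ω`. -/
def machineSet {d l : ℕ} (ω : Fin d → Fin l) (j : Fin l) : Finset (Fin d) :=
  Finset.univ.filter fun a => ω a = j

open scoped Classical in
/-- The probability, over the uniformly random assignment `ω` of the `d` elements to the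
`l` machines, of the event `p ω`. -/
noncomputable def assignProb {d l : ℕ} (p : (Fin d → Fin l) → Prop) : ℝ :=
  ((Finset.univ.filter fun ω : Fin d → Fin l => p ω).card : ℝ) /
    (Fintype.card (Fin d → Fin l) : ℝ)

theorem greedyStep_subset {d : ℕ} (f : Finset (Fin d) → ℝ) {S A : Finset (Fin d)}
    (hA : A ⊆ S) : greedyStep f S A ⊆ S := by
  unfold greedyStep
  split_ifs with h
  · refine Finset.insert_subset ?_ hA
    exact (Finset.mem_sdiff.mp (Finset.mem_filter.mp (Finset.min'_mem _ _)).1).1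
  · exact hA

theorem greedy_subset {d : ℕ} (f : Finset (Fin d) → ℝ) (S : Finset (Fin d)) (k : ℕ) :
    greedy f S k ⊆ S := by
  induction k with
  | zero => exact Finset.empty_subset S
  | succ k ih => exact greedyStep_subset f ih

theorem mem_biUnion_greedy_machineSet_iff {d l : ℕ} (f : Finset (Fin d) → ℝ) (k : ℕ)
    (x : Fin d) (ω : Fin d → Fin l) :
    (x ∈ Finset.univ.biUnion fun j : Fin l => greedy f (machineSet ω j) k) ↔
      x ∈ greedy f (machineSet ω (ω x)) k := by
  simp only [Finset.mem_biUnion, Finset.mem_univ, true_and]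
  refine ⟨fun ⟨j, hj⟩ => ?_, fun h => ⟨_, h⟩⟩
  have hx : ω x = j := (Finset.mem_filter.mp (greedy_subset f _ k hj)).2
  rwa [hx]

theorem machineSet_update_self {d l : ℕ} (ω : Fin d → Fin l) (x : Fin d) (j : Fin l) :
    machineSet (Function.update ω x j) j = insert x (machineSet ω j) := by
  ext a
  by_cases h : a = x <;> simp [machineSet, h]

/-- Exchange the value of an assignment at `x` with a separate value. -/
def swapValueAt {d l : ℕ} (x : Fin d) :
    (Fin l × (Fin d → Fin l)) ≃ (Fin l × (Fin d → Fin l)) :=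
  Function.Involutive.toPerm (fun p => (p.2 x, Function.update p.2 x p.1))
    (fun p => by simp)

/-- Resampling one coordinate preserves the uniform distribution on assignments. -/
theorem sum_assignProb_update {d l : ℕ} (x : Fin d) (p : (Fin d → Fin l) → Prop) :
    ∑ j : Fin l, assignProb (fun ω => p (Function.update ω x j)) = l * assignProb p := by
  classical
  have h : ∑ q : Fin l × (Fin d → Fin l), (if p (Function.update q.2 x q.1) then (1 : ℝ) else 0) =
      ∑ q : Fin l × (Fin d → Fin l), if p q.2 then (1 : ℝ) else 0 :=
    (swapValueAt x).sum_comp (fun q => if p q.2 then (1 : ℝ) else 0)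
  rw [Fintype.sum_prod_type, Fintype.sum_prod_type] at h
  simp only [Finset.sum_boole, Finset.sum_const, Finset.card_univ,
    Fintype.card_fin, nsmul_eq_mul] at h
  simp only [assignProb, ← Finset.sum_div, ← mul_div_assoc]
  congr 1

/-- **Probability of landing in some local greedy solution.** In the `DistributedGreedy`
setup, where each element of `Fin d` is assigned independently and uniformly at random
to one of `l` machines (producing the random partition `A_1, …, A_l`) and
`G_j = Greedy(A_j, k)`, for any element `x`,
`P(x ∈ G_1 ∪ ⋯ ∪ G_l) = (1/l) · ∑_j P(x ∈ Greedy(A_j ∪ {x}, k))`. -/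
theorem prob_mem_union_local_greedy (d l k : ℕ) (hl : 0 < l)
    (f : Finset (Fin d) → ℝ) (x : Fin d) :
    assignProb (fun ω : Fin d → Fin l =>
        x ∈ Finset.univ.biUnion fun j : Fin l => greedy f (machineSet ω j) k) =
      (1 / (l : ℝ)) * ∑ j : Fin l,
        assignProb (fun ω : Fin d → Fin l =>
          x ∈ greedy f (insert x (machineSet ω j)) k) := by
  have hl' : (l : ℝ) ≠ 0 := by exact_mod_cast hl.ne'
  have h := sum_assignProb_update x
    (fun ω : Fin d → Fin l => x ∈ greedy f (machineSet ω (ω x)) k)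
  simp only [Function.update_self, machineSet_update_self] at h
  simp only [mem_biUnion_greedy_machineSet_iff]
  rw [h, one_div, inv_mul_cancel_left₀ hl']
end

section
/- Let n, k ≥ 1, δ ∈ (0,1), and let A, B ⊆ [n] with |B \ A| ≤ k. Let s = ⌈n·log(1/δ)/k⌉ and assume s ≤ n − |A|. If C is a uniformly random subset of [n] \ A of size s, then P(C ∩ (B \ A) ≠ ∅) ≥ (1 − δ)·|B \ A| / k. -/
open Finset

theorem choose_le_exp_mul_choose_succ {M N : ℕ} (s : ℕ) (h : M + 1 ≤ N) :
    (M.choose s : ℝ) ≤ Real.exp (-(s / N : ℝ)) * ((M + 1).choose s : ℝ) := by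
  rcases lt_or_ge M s with hs | hs
  · rw [Nat.choose_eq_zero_of_lt hs]
    simp only [Nat.cast_zero]
    positivity
  have hM : (0 : ℝ) < (M : ℝ) + 1 := by positivity
  have hN : (M : ℝ) + 1 ≤ N := by exact_mod_cast h
  have key : (M.choose s : ℝ) * (M + 1) = ((M + 1).choose s : ℝ) * (M + 1 - s) := by
    have := congrArg (Nat.cast : ℕ → ℝ) (Nat.choose_mul_succ_eq M s)
    rw [Nat.cast_mul, Nat.cast_mul, Nat.cast_sub (by lia)] at this
    exact_mod_cast this
  have hexp : 1 - (s : ℝ) / (M + 1) ≤ Real.exp (-(s / N : ℝ)) := by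
    refine (Real.one_sub_le_exp_neg _).trans (Real.exp_le_exp.2 ?_)
    gcongr
  calc (M.choose s : ℝ) = (1 - (s : ℝ) / (M + 1)) * ((M + 1).choose s : ℝ) := by
        field_simp
        linarith
    _ ≤ _ := by gcongr

theorem choose_le_exp_pow_mul_choose_add {N : ℕ} (M s j : ℕ) (h : M + j ≤ N) :
    (M.choose s : ℝ) ≤ Real.exp (-(s / N : ℝ)) ^ j * ((M + j).choose s : ℝ) := by
  induction j with
  | zero => simp
  | succ j ih =>
    refine (ih (by lia)).trans ?_
    rw [pow_succ, mul_assoc, ← add_assoc]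
    gcongr
    exact choose_le_exp_mul_choose_succ s h

theorem card_filter_inter_nonempty_powersetCard {α : Type*} [DecidableEq α] {U T : Finset α}
    (hT : T ⊆ U) (s : ℕ) [DecidablePred fun C : Finset α => (C ∩ T).Nonempty] :
    (#{C ∈ U.powersetCard s | (C ∩ T).Nonempty} : ℝ) =
      ((#U).choose s : ℝ) - ((#U - #T).choose s : ℝ) := by
  have hmiss : {C ∈ U.powersetCard s | ¬ (C ∩ T).Nonempty} = (U \ T).powersetCard s := by
    ext C
    simp only [mem_filter, mem_powersetCard, not_nonempty_iff_eq_empty, subset_sdiff,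
      disjoint_iff_inter_eq_empty]
    tauto
  have hsum := card_filter_add_card_filter_not (s := U.powersetCard s)
    (fun C : Finset α => (C ∩ T).Nonempty)
  rw [hmiss, card_powersetCard, card_powersetCard, card_sdiff_of_subset hT] at hsum
  rw [← hsum]
  push_cast
  ring

open scoped Classical in
/-- **Overlap probability for a uniformly random subsample.** Let `n, k ≥ 1`,
`δ ∈ (0,1)`, `A, B ⊆ [n]` with `|B \ A| ≤ k`, and `s = ⌈n·log(1/δ)/k⌉` with
`s ≤ n - |A|`. If `C` is a uniformly random subset of `[n] \ A` of size `s`, then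
`P(C ∩ (B \ A) ≠ ∅) ≥ (1 - δ)·|B \ A| / k`. -/
theorem subsample_overlap_prob (n k : ℕ) (hn : 1 ≤ n) (hk : 1 ≤ k)
    (δ : ℝ) (hδ0 : 0 < δ) (hδ1 : δ < 1)
    (A B : Finset (Fin n)) (hBA : (B \ A).card ≤ k)
    (s : ℕ) (hs : s = ⌈(n : ℝ) * Real.log (1 / δ) / (k : ℝ)⌉₊)
    (hsle : s ≤ n - A.card) :
    (1 - δ) * ((B \ A).card : ℝ) / (k : ℝ) ≤
      (((((Finset.univ : Finset (Fin n)) \ A).powersetCard s).filter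
          fun C => (C ∩ (B \ A)).Nonempty).card : ℝ) /
        (((((Finset.univ : Finset (Fin n)) \ A).powersetCard s)).card : ℝ) := by
  have hTU : B \ A ⊆ univ \ A := sdiff_subset_sdiff (subset_univ B) le_rfl
  have hU : #(univ \ A) = n - #A := by
    rw [card_sdiff_of_subset (subset_univ A), card_univ, Fintype.card_fin]
  have hm := card_le_card hTU
  rw [card_filter_inter_nonempty_powersetCard hTU, card_powersetCard]
  rw [hU] at hm ⊢
  set m := #(B \ A)
  have hk0 : (0 : ℝ) < k := by exact_mod_cast hk
  have hn0 : (0 : ℝ) < n := by exact_mod_cast hn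
  have hpos : (0 : ℝ) < ((n - #A).choose s : ℝ) := by exact_mod_cast Nat.choose_pos hsle
  have hmiss := choose_le_exp_pow_mul_choose_add (N := n) (n - #A - m) s m (by lia)
  rw [Nat.sub_add_cancel hm] at hmiss
  have hceil : -(s / n : ℝ) ≤ Real.log δ / k := by
    have h := Nat.le_ceil ((n : ℝ) * Real.log (1 / δ) / (k : ℝ))
    rw [← hs, one_div, Real.log_inv] at h
    have : -(Real.log δ / k) ≤ s / n := by
      rw [le_div_iff₀ hn0]
      exact le_of_eq_of_le (by ring) h
    linarith
  have hbound : Real.exp (-(s / n : ℝ)) ^ m ≤ 1 - (1 - δ) * m / k := by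
    calc Real.exp (-(s / n : ℝ)) ^ m ≤ Real.exp (Real.log δ / k) ^ m := by gcongr
      _ = (1 + (δ - 1)) ^ ((m : ℝ) / k) := by
        rw [← Real.exp_nat_mul, add_sub_cancel, Real.rpow_def_of_pos hδ0]
        congr 1
        ring
      _ ≤ 1 + (m : ℝ) / k * (δ - 1) :=
        rpow_one_add_le_one_add_mul_self (by linarith) (by positivity)
          ((div_le_one hk0).2 (by exact_mod_cast hBA))
      _ = _ := by ring
  rw [le_div_iff₀ hpos]
  nlinarith [mul_le_mul_of_nonneg_right hbound hpos.le]
end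

section
/- Let f be a monotone set function on [n], let A, B ⊆ [n] with |B| ≤ k, and let δ ∈ (0,1). Suppose γ > 0 satisfies the submodularity-ratio inequality ∑_{j ∈ B\A}(f(A ∪ {j}) − f(A)) ≥ γ·(f(A ∪ B) − f(A)). Let s = ⌈n·log(1/δ)/k⌉, assume s ≤ n − |A|, and let C be a uniformly random subset of [n] \ A of size s. Then E[max_{v ∈ C}(f(A ∪ {v}) − f(A))] ≥ ((1 − δ)·γ/k)·(f(B) − f(A)). -/
open Finset

/-- Averaging a weight over the part of a set that meets `D`, summed over all `s`-subsets of `U`: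
by symmetry every element of `D` contributes equally. -/
theorem card_mul_sum_powersetCard_average {α : Type*} [DecidableEq α] (U D : Finset α)
    (hD : D ⊆ U) (s : ℕ) (w : α → ℝ) :
    (#D : ℝ) * ∑ C ∈ U.powersetCard s, (∑ j ∈ C ∩ D, w j) / #(C ∩ D) =
      (∑ j ∈ D, w j) * #{C ∈ U.powersetCard s | (C ∩ D).Nonempty} := by
  set c : α → ℝ := fun j => ∑ C ∈ U.powersetCard s with j ∈ C, ((#(C ∩ D) : ℝ))⁻¹ with hc
  have expand (v : α → ℝ) :
      ∑ C ∈ U.powersetCard s, (∑ j ∈ C ∩ D, v j) / #(C ∩ D) = ∑ j ∈ D, v j * c j := by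
    simp only [hc, div_eq_mul_inv, Finset.sum_mul, Finset.mul_sum, Finset.sum_filter]
    rw [Finset.sum_comm]
    refine Finset.sum_congr rfl fun C _ => ?_
    rw [Finset.inter_comm, ← Finset.filter_mem_eq_inter, Finset.sum_filter]
    exact Finset.sum_congr rfl fun j _ => by split_ifs <;> simp
  have c_eq : ∀ i ∈ D, ∀ j ∈ D, c i = c j := by
    intro i hi j hj
    have stable : ∀ E : Finset α, i ∈ E → j ∈ E → E.map (Equiv.swap i j).toEmbedding = E := by
      intro E hiE hjE
      ext x
      rw [Finset.mem_map_equiv, Equiv.symm_swap]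
      by_cases h1 : x = i
      · subst h1; simp [hiE, hjE]
      by_cases h2 : x = j
      · subst h2; simp [hiE, hjE]
      rw [Equiv.swap_apply_of_ne_of_ne h1 h2]
    have maps : ∀ C ∈ U.powersetCard s,
        C.map (Equiv.swap i j).toEmbedding ∈ U.powersetCard s := by
      intro C hC
      rw [Finset.mem_powersetCard] at hC ⊢
      refine ⟨?_, by simpa using hC.2⟩
      rw [← stable U (hD hi) (hD hj)]
      exact Finset.map_subset_map.2 hC.1
    have invol : ∀ C : Finset α,
        (C.map (Equiv.swap i j).toEmbedding).map (Equiv.swap i j).toEmbedding = C := by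
      intro C
      ext x
      simp [Finset.mem_map_equiv]
    refine Finset.sum_nbij' (fun C => C.map (Equiv.swap i j).toEmbedding)
      (fun C => C.map (Equiv.swap i j).toEmbedding) ?_ ?_ (fun C _ => invol C)
      (fun C _ => invol C) ?_
    · intro C hC
      rw [Finset.mem_filter] at hC ⊢
      exact ⟨maps C hC.1, by simpa [Finset.mem_map_equiv] using hC.2⟩
    · intro C hC
      rw [Finset.mem_filter] at hC ⊢
      exact ⟨maps C hC.1, by simpa [Finset.mem_map_equiv] using hC.2⟩
    · intro C _
      have : #(C.map (Equiv.swap i j).toEmbedding ∩ D) = #(C ∩ D) := by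
        conv_lhs => rw [← stable D hi hj, ← Finset.map_inter, Finset.card_map]
      rw [this]
  have total : ∑ j ∈ D, c j = #{C ∈ U.powersetCard s | (C ∩ D).Nonempty} := by
    have h := expand fun _ => 1
    simp only [one_mul] at h
    rw [← h, Finset.card_filter]
    push_cast
    refine Finset.sum_congr rfl fun C _ => ?_
    rcases (C ∩ D).eq_empty_or_nonempty with h0 | h0
    · simp [h0]
    · have : (#(C ∩ D) : ℝ) ≠ 0 := by exact_mod_cast h0.card_pos.ne'
      simp [h0, this]
  rw [expand, ← total, Finset.sum_mul_sum, Finset.mul_sum]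
  refine Finset.sum_congr rfl fun i hi => ?_
  rw [Finset.sum_congr rfl fun j hj => by rw [c_eq j hj i hi], Finset.sum_const, nsmul_eq_mul]

theorem Nat.descFactorial_sub_mul_pow_le (N m s : ℕ) :
    (N - m).descFactorial s * N ^ s ≤ N.descFactorial s * (N - m) ^ s := by
  induction s with
  | zero => simp
  | succ s ih =>
    have key : (N - m - s) * N ≤ (N - s) * (N - m) := by
      rcases le_total (N - m) s with h | h
      · simp [Nat.sub_eq_zero_of_le h]
      rcases le_total N m with h' | h'
      · simp [Nat.sub_eq_zero_of_le h']
      obtain ⟨a, rfl⟩ := Nat.exists_eq_add_of_le h'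
      rw [Nat.add_sub_cancel_left] at h ⊢
      obtain ⟨b, rfl⟩ := Nat.exists_eq_add_of_le h
      rw [Nat.add_sub_cancel_left, show m + (s + b) - s = m + b by lia]
      nlinarith
    rw [Nat.descFactorial_succ, Nat.descFactorial_succ, pow_succ, pow_succ]
    calc _ = ((N - m - s) * N) * ((N - m).descFactorial s * N ^ s) := by ring
      _ ≤ ((N - s) * (N - m)) * (N.descFactorial s * (N - m) ^ s) := Nat.mul_le_mul key ih
      _ = _ := by ring

/-- The probability that a uniform `s`-subset of an `N`-set misses a fixed `m`-subset is at most
`exp (-(m s / N))`. -/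
theorem Nat.choose_sub_le_exp_mul_choose {N m : ℕ} (s : ℕ) (hN : 0 < N) (hm : m ≤ N) :
    ((N - m).choose s : ℝ) ≤ Real.exp (-(m * s / N)) * N.choose s := by
  have hN' : (0 : ℝ) < N := by exact_mod_cast hN
  have hfac : (0 : ℝ) < s.factorial := by exact_mod_cast s.factorial_pos
  have h : ((N - m).descFactorial s : ℝ) * N ^ s ≤ N.descFactorial s * ((N : ℝ) - m) ^ s := by
    have := Nat.descFactorial_sub_mul_pow_le N m s
    rw [← Nat.cast_sub hm]
    exact_mod_cast this
  rw [Nat.descFactorial_eq_factorial_mul_choose, Nat.descFactorial_eq_factorial_mul_choose] at h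
  push_cast at h
  have h1 : ((N - m).choose s : ℝ) ≤ (1 - m / N : ℝ) ^ s * N.choose s := by
    have hsplit : ((N : ℝ) - m) ^ s = (1 - m / N : ℝ) ^ s * N ^ s := by
      rw [← mul_pow]; congr 1; field_simp
    rw [hsplit] at h
    refine le_of_mul_le_mul_right ?_ (mul_pos hfac (pow_pos hN' s))
    linarith
  refine h1.trans (mul_le_mul_of_nonneg_right ?_ (Nat.cast_nonneg _))
  have h2 : (0 : ℝ) ≤ 1 - m / N := by
    rw [sub_nonneg, div_le_one hN']; exact_mod_cast hm
  calc (1 - m / N : ℝ) ^ s ≤ Real.exp (-(m / N)) ^ s :=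
        pow_le_pow_left₀ h2 (Real.one_sub_le_exp_neg _) s
    _ = _ := by rw [← Real.exp_nat_mul]; congr 1; ring

theorem card_filter_powersetCard_inter_nonempty_ge {α : Type*} [DecidableEq α]
    {U D : Finset α} (hD : D ⊆ U) (hDne : D.Nonempty) (s : ℕ) :
    (1 - Real.exp (-(#D * s / #U))) * #(U.powersetCard s) ≤
      #{C ∈ U.powersetCard s | (C ∩ D).Nonempty} := by
  have hmiss : {C ∈ U.powersetCard s | ¬ (C ∩ D).Nonempty} = (U \ D).powersetCard s := by
    ext C
    simp only [Finset.mem_filter, Finset.mem_powersetCard, Finset.subset_sdiff,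
      Finset.not_nonempty_iff_eq_empty, ← Finset.disjoint_iff_inter_eq_empty]
    tauto
  have hsum := Finset.card_filter_add_card_filter_not (s := U.powersetCard s)
    fun C => (C ∩ D).Nonempty
  rw [hmiss, Finset.card_powersetCard, Finset.card_sdiff_of_subset hD] at hsum
  have h := Nat.choose_sub_le_exp_mul_choose s (hDne.mono hD).card_pos (Finset.card_le_card hD)
  rw [Finset.card_powersetCard] at hsum ⊢
  have hsum' : (#{C ∈ U.powersetCard s | (C ∩ D).Nonempty} : ℝ) + ((#U - #D).choose s : ℕ) =
      ((#U).choose s : ℕ) := by exact_mod_cast hsum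
  linarith

theorem exp_neg_le_one_sub_of_rate_le {n k m N s : ℕ} {δ : ℝ} (hk : 1 ≤ k) (hmk : m ≤ k) (hN : 0 < N)
    (hNn : N ≤ n) (hδ0 : 0 < δ) (hs : (n : ℝ) * Real.log (1 / δ) / k ≤ s) :
    Real.exp (-(m * s / N)) ≤ 1 - m / k * (1 - δ) := by
  have hk' : (0 : ℝ) < k := by exact_mod_cast hk
  have hN' : (0 : ℝ) < N := by exact_mod_cast hN
  have hNn' : (N : ℝ) ≤ n := by exact_mod_cast hNn
  have hn' : (0 : ℝ) < n := hN'.trans_le hNn'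
  have hrate : Real.log (1 / δ) / k ≤ s / N := by
    calc Real.log (1 / δ) / k ≤ s / n := by
          rw [le_div_iff₀ hn']; refine le_of_eq_of_le ?_ hs; ring
      _ ≤ s / N := div_le_div_of_nonneg_left (Nat.cast_nonneg _) hN' hNn'
  calc Real.exp (-(m * s / N)) ≤ Real.exp (Real.log δ * (m / k)) := by
        have := mul_le_mul_of_nonneg_left hrate (Nat.cast_nonneg (α := ℝ) m)
        rw [one_div, Real.log_inv] at this
        refine Real.exp_le_exp.2 ?_
        calc -(m * s / N : ℝ) = -(m * (s / N)) := by ring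
          _ ≤ -(m * (-Real.log δ / k)) := neg_le_neg this
          _ = _ := by ring
    _ = (1 + (δ - 1)) ^ (m / k : ℝ) := by
        rw [add_sub_cancel, Real.rpow_def_of_pos hδ0]
    _ ≤ 1 + m / k * (δ - 1) := rpow_one_add_le_one_add_mul_self (by linarith)
        (by positivity) ((div_le_one hk').2 (by exact_mod_cast hmk))
    _ = _ := by ring

open scoped Classical in
/-- **Expected best marginal gain from a random subsample** (generalization of Lemma 2 of
Mirzasoleiman et al. to weakly submodular functions). Let `f` be monotone on subsets of
`[n]`, `A, B ⊆ [n]` with `|B| ≤ k`, `δ ∈ (0,1)`, and suppose `γ > 0` satisfies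
`∑_{j ∈ B \ A} (f (A ∪ {j}) - f A) ≥ γ · (f (A ∪ B) - f A)`. Let
`s = ⌈n·log(1/δ)/k⌉ ≤ n - |A|`, and let `C` be a uniformly random subset of `[n] \ A` of
size `s`. Then `E[max_{v ∈ C} (f (A ∪ {v}) - f A)] ≥ ((1 - δ)·γ/k)·(f B - f A)`. -/
theorem subsample_expected_gain (n k : ℕ) (hk : 1 ≤ k)
    (f : Finset (Fin n) → ℝ)
    (hmono : ∀ A B : Finset (Fin n), A ⊆ B → f A ≤ f B)
    (A B : Finset (Fin n)) (hB : B.card ≤ k)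
    (δ γ : ℝ) (hδ0 : 0 < δ) (hδ1 : δ < 1) (hγ : 0 < γ)
    (hsub : γ * (f (A ∪ B) - f A) ≤ ∑ j ∈ B \ A, (f (insert j A) - f A))
    (s : ℕ) (hs : s = ⌈(n : ℝ) * Real.log (1 / δ) / (k : ℝ)⌉₊)
    (hsle : s ≤ n - A.card) :
    (1 - δ) * γ / (k : ℝ) * (f B - f A) ≤
      (∑ C ∈ ((Finset.univ : Finset (Fin n)) \ A).powersetCard s,
          if h : C.Nonempty then C.sup' h fun v => f (insert v A) - f A else 0) /
        (((((Finset.univ : Finset (Fin n)) \ A).powersetCard s)).card : ℝ) := by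
  set U : Finset (Fin n) := Finset.univ \ A with hU
  set D : Finset (Fin n) := B \ A with hDdef
  set w : Fin n → ℝ := fun v => f (insert v A) - f A with hw
  have hw0 : ∀ v, 0 ≤ w v := fun v => sub_nonneg.2 (hmono _ _ (Finset.subset_insert v A))
  have hDU : D ⊆ U := Finset.sdiff_subset_sdiff (Finset.subset_univ B) le_rfl
  have hUcard : #U = n - #A := by simp [hU, Finset.card_univ_sdiff]
  have hk' : (0 : ℝ) < k := by exact_mod_cast hk
  have hP : (0 : ℝ) < #(U.powersetCard s) := by
    rw [Finset.card_powersetCard, hUcard]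
    exact_mod_cast Nat.choose_pos hsle
  have hgain : (1 - δ) * γ / k * (f B - f A) ≤ (1 - δ) / k * ∑ j ∈ D, w j := by
    have h1 : f B - f A ≤ f (A ∪ B) - f A :=
      sub_le_sub_right (hmono _ _ Finset.subset_union_right) _
    calc (1 - δ) * γ / k * (f B - f A) = (1 - δ) / k * (γ * (f B - f A)) := by ring
      _ ≤ _ := mul_le_mul_of_nonneg_left ((mul_le_mul_of_nonneg_left h1 hγ.le).trans hsub)
        (div_nonneg (by linarith) hk'.le)
  have hmax : ∑ C ∈ U.powersetCard s, (∑ j ∈ C ∩ D, w j) / #(C ∩ D) ≤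
      ∑ C ∈ U.powersetCard s, if h : C.Nonempty then C.sup' h w else 0 := by
    refine Finset.sum_le_sum fun C _ => ?_
    split_ifs with hC
    · rcases (C ∩ D).eq_empty_or_nonempty with h0 | h0
      · obtain ⟨v, hv⟩ := hC
        simpa [h0] using (hw0 v).trans (Finset.le_sup' w hv)
      · rw [div_le_iff₀ (by exact_mod_cast h0.card_pos), mul_comm, ← nsmul_eq_mul]
        exact Finset.sum_le_card_nsmul _ _ _ fun j hj =>
          Finset.le_sup' w (Finset.mem_inter.1 hj).1
    · simp [Finset.not_nonempty_iff_eq_empty.1 hC]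
  refine hgain.trans ?_
  rw [le_div_iff₀ hP]
  refine le_trans ?_ hmax
  rcases D.eq_empty_or_nonempty with hD | hD
  · simp [hD]
  have hm : (0 : ℝ) < #D := by exact_mod_cast hD.card_pos
  have hexp := exp_neg_le_one_sub_of_rate_le (m := #D) (N := #U) (n := n) (s := s) hk
    ((Finset.card_le_card Finset.sdiff_subset).trans hB) (hD.mono hDU).card_pos
    (by lia) hδ0 (hs ▸ Nat.le_ceil _)
  have hhit : (#D / k * (1 - δ)) * #(U.powersetCard s) ≤
      #{C ∈ U.powersetCard s | (C ∩ D).Nonempty} :=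
    (mul_le_mul_of_nonneg_right (by linarith) hP.le).trans
      (card_filter_powersetCard_inter_nonempty_ge hDU hD s)
  refine le_of_mul_le_mul_left ?_ hm
  rw [card_mul_sum_powersetCard_average U D hDU s w]
  refine le_of_eq_of_le ?_ (mul_le_mul_of_nonneg_left hhit (Finset.sum_nonneg fun j _ => hw0 j))
  ring
end
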